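/- Let μ, κ, γ, M₀ > 0, let (P,γ) be an admissible pair with pressure potential W, and let (ρ,u,c) be a smooth periodic solution of the non-local Navier–Stokes–Korteweg system on [0,∞) with initial data (ρ₀,u₀) satisfying M₀⁻¹ ≤ ρ₀(x) ≤ M₀ for all x. Define K_{P_γ} := max_{λ∈[(2M₀)⁻¹, 2M₀]} |P_γ(λ)|, Σ₀ := μ·∂_x u₀ − P_γ(ρ₀), Σ := μ·∂_x u − P_γ(ρ), and K_u := (8/μ²)·(2 + 5·M₀·μ)·(‖Σ₀‖²_{L²(𝕋)} + 1 + K²_{P_γ}). Suppose that for some T̃₀ ∈ (0,1): (2M₀)⁻¹ ≤ ρ(t,x) ≤ 2M₀ on [0,T̃₀] × ℝ and sup_{t∈[0,T̃₀]} ‖∂_x u(t,·)‖²_{L²(𝕋)} + ∫₀^{T̃₀} ‖∂_x Σ(t,·)‖²_{L²(𝕋)} dt ≤ K_u. Then there exist constants T_ρ > 0 and K_d > 0, depending only on M₀, ‖u₀‖_{H¹(𝕋)}, μ, γ, κ, P and W, such that if T̃₀ < T_ρ, then ∫₀^{T̃₀} ‖∂_x u(t,·)‖_{L∞(𝕋)}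 dt ≤ √(T̃₀)·K_d and (2/(3M₀)) ≤ ρ(t,x) ≤ (3/2)·M₀ for all (t,x) ∈ [0,T̃₀] × ℝ. -/

import Mathlib

open MeasureTheory Filter Set

/-- The `L²` norm of a `1`-periodic function, computed over one period. -/
noncomputable def L2norm (f : ℝ → ℝ) : ℝ := Real.sqrt (∫ x in (0:ℝ)..1, f x ^ 2)

/-- The `H¹` norm of a `1`-periodic function, computed over one period. -/
noncomputable def H1norm (f : ℝ → ℝ) : ℝ :=
  Real.sqrt (∫ x in (0:ℝ)..1, f x ^ 2 + deriv f x ^ 2)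

/-- The `H²` norm of a `1`-periodic function, computed over one period. -/
noncomputable def H2norm (f : ℝ → ℝ) : ℝ :=
  Real.sqrt (∫ x in (0:ℝ)..1, f x ^ 2 + deriv f x ^ 2 + deriv (deriv f) x ^ 2)

/-- The sup-norm of a `1`-periodic function, computed over one period. -/
noncomputable def LinfNorm (f : ℝ → ℝ) : ℝ := sSup ((fun x => |f x|) '' Set.Icc (0:ℝ) 1)

/-- The `W^{1,∞}` norm of a `1`-periodic function. -/
noncomputable def W1infNorm (f : ℝ → ℝ) : ℝ := LinfNorm f + LinfNorm (deriv f)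

/-- The artificial pressure `P_γ(r) = P(r) + (γ/2) r²`. -/
noncomputable def artificialPressure (P : ℝ → ℝ) (γ : ℝ) (r : ℝ) : ℝ := P r + γ / 2 * r ^ 2

/-- A pair `(P, γ)` is admissible (with exponent `β` and limit `a`). -/
structure IsAdmissiblePair (P : ℝ → ℝ) (γ β a : ℝ) : Prop where
  gamma_pos : 0 < γ
  beta_ge : 2 ≤ β
  a_pos : 0 < a
  nonneg : ∀ r, 0 ≤ r → 0 ≤ P r
  smooth : ContDiffOn ℝ 1 P (Set.Ici 0)
  zero : P 0 = 0
  lim : Filter.Tendsto (fun r => deriv P r / r ^ (β - 1)) Filter.atTop (nhds a)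
  mono : MonotoneOn (artificialPressure P γ) (Set.Ici 0)

/-- `W` is a pressure potential for `P`: `W : [0,∞) → [0,∞)`, twice continuously
differentiable on `(0,∞)`, with `W''(r)·r = P'(r)` for `r > 0`. -/
structure IsPressurePotential (P W : ℝ → ℝ) : Prop where
  nonneg : ∀ r, 0 ≤ r → 0 ≤ W r
  smooth : ContDiffOn ℝ 2 W (Set.Ioi 0)
  relation : ∀ r : ℝ, 0 < r → deriv (deriv W) r * r = deriv P r

/-- A smooth `1`-periodic-in-space solution of the non-local Navier–Stokes–Korteweg
system on the time set `S`, with initial data `(ρ₀, u₀)`. -/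
structure IsNSKSolution (μ κ γ : ℝ) (P : ℝ → ℝ) (S : Set ℝ)
    (ρ u c : ℝ → ℝ → ℝ) (ρ₀ u₀ : ℝ → ℝ) : Prop where
  smooth_rho : ContDiffOn ℝ (⊤ : ℕ∞) (fun p : ℝ × ℝ => ρ p.1 p.2) (S ×ˢ (Set.univ : Set ℝ))
  smooth_u : ContDiffOn ℝ (⊤ : ℕ∞) (fun p : ℝ × ℝ => u p.1 p.2) (S ×ˢ (Set.univ : Set ℝ))
  smooth_c : ContDiffOn ℝ (⊤ : ℕ∞) (fun p : ℝ × ℝ => c p.1 p.2) (S ×ˢ (Set.univ : Set ℝ))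
  periodic_rho : ∀ t x, ρ t (x + 1) = ρ t x
  periodic_u : ∀ t x, u t (x + 1) = u t x
  periodic_c : ∀ t x, c t (x + 1) = c t x
  rho_pos : ∀ t x, 0 < ρ t x
  mass : ∀ t ∈ S, ∀ x : ℝ,
    deriv (fun s => ρ s x) t + deriv (fun y => ρ t y * u t y) x = 0
  momentum : ∀ t ∈ S, ∀ x : ℝ,
    deriv (fun s => ρ s x * u s x) t
      + deriv (fun y => ρ t y * u t y ^ 2) x
      + deriv (fun y => P (ρ t y)) x
      - μ * deriv (deriv (u t)) x
      - γ * ρ t x * deriv (fun y => c t y - ρ t y) x = 0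
  elliptic : ∀ t ∈ S, ∀ x : ℝ,
    -κ * deriv (deriv (c t)) x + γ * (c t x - ρ t x) = 0
  init_rho : ∀ x, ρ 0 x = ρ₀ x
  init_u : ∀ x, u 0 x = u₀ x

open scoped NNReal

section SpaceTime

variable {f : ℝ → ℝ → ℝ}

theorem uniqueDiffOn_Ici_prod_univ :
    UniqueDiffOn ℝ (Set.Ici (0:ℝ) ×ˢ (Set.univ : Set ℝ)) :=
  (uniqueDiffOn_Ici 0).prod uniqueDiffOn_univ

theorem hasDerivAt_slice
    (hf : ContDiffOn ℝ (⊤ : ℕ∞) (fun p : ℝ × ℝ => f p.1 p.2) (Set.Ici 0 ×ˢ Set.univ))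
    {t : ℝ} (ht : 0 ≤ t) (x : ℝ) :
    HasDerivAt (f t) (fderivWithin ℝ (fun p : ℝ × ℝ => f p.1 p.2)
      (Set.Ici 0 ×ˢ Set.univ) (t, x) (0, 1)) x := by
  have hd := ((hf.differentiableOn (by simp)) (t, x) ⟨ht, trivial⟩).hasFDerivWithinAt
  have hc : HasDerivAt (fun y : ℝ => (t, y)) ((0:ℝ), (1:ℝ)) x :=
    (hasDerivAt_const x t).prodMk (hasDerivAt_id x)
  exact hd.comp_hasDerivAt x hc (Eventually.of_forall fun y => ⟨ht, trivial⟩)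

theorem contDiffOn_deriv_slice
    (hf : ContDiffOn ℝ (⊤ : ℕ∞) (fun p : ℝ × ℝ => f p.1 p.2) (Set.Ici 0 ×ˢ Set.univ)) :
    ContDiffOn ℝ (⊤ : ℕ∞) (fun p : ℝ × ℝ => deriv (f p.1) p.2) (Set.Ici 0 ×ˢ Set.univ) := by
  have h1 : ContDiffOn ℝ (⊤ : ℕ∞) (fderivWithin ℝ (fun p : ℝ × ℝ => f p.1 p.2)
      (Set.Ici 0 ×ˢ Set.univ)) (Set.Ici 0 ×ˢ Set.univ) :=
    hf.fderivWithin uniqueDiffOn_Ici_prod_univ (by simp)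
  exact (h1.clm_apply contDiffOn_const).congr fun p hp => (hasDerivAt_slice hf hp.1 p.2).deriv

theorem continuous_slice
    (hf : ContDiffOn ℝ (⊤ : ℕ∞) (fun p : ℝ × ℝ => f p.1 p.2) (Set.Ici 0 ×ˢ Set.univ))
    {t : ℝ} (ht : 0 ≤ t) : Continuous (f t) :=
  continuous_iff_continuousAt.2 fun x => (hasDerivAt_slice hf ht x).continuousAt

theorem exists_abs_le_of_periodic
    (hf : ContinuousOn (fun p : ℝ × ℝ => f p.1 p.2) (Set.Ici 0 ×ˢ Set.univ))
    (hper : ∀ t, Function.Periodic (f t) 1) (T : ℝ) :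
    ∃ L : ℝ≥0, ∀ t ∈ Set.Icc 0 T, ∀ x, |f t x| ≤ L := by
  obtain ⟨C, hC⟩ := (isCompact_Icc.prod isCompact_Icc).exists_bound_of_continuousOn
    (hf.mono (Set.prod_mono (Set.Icc_subset_Ici_self (a := T) (b := (0:ℝ)))
      (Set.subset_univ (Set.Icc (0:ℝ) 1))))
  refine ⟨C.toNNReal, fun t ht x => ?_⟩
  obtain ⟨y, hy, hxy⟩ := (hper t).exists_mem_Ico₀ one_pos x
  rw [hxy]
  exact (hC (t, y) ⟨ht, Set.Ico_subset_Icc_self hy⟩).trans (Real.le_coe_toNNReal C)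

theorem periodic_deriv {g : ℝ → ℝ} (hg : Function.Periodic g 1) :
    Function.Periodic (deriv g) 1 := fun x => by
  rw [← deriv_comp_add_const]
  congr 1
  exact funext hg

end SpaceTime

theorem integral_abs_le_sqrt_mul {f : ℝ → ℝ} (hf : Continuous f) {a b : ℝ} (hab : a ≤ b) :
    ∫ x in a..b, |f x| ≤ Real.sqrt (b - a) * Real.sqrt (∫ x in a..b, f x ^ 2) := by
  rcases hab.eq_or_lt with rfl | h
  · simp
  set I := ∫ x in a..b, |f x| with hI
  set J := ∫ x in a..b, f x ^ 2 with hJ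
  have hL : 0 < b - a := sub_pos.2 h
  have h0 : 0 ≤ ∫ x in a..b, ((b - a) * |f x| - I) ^ 2 :=
    intervalIntegral.integral_nonneg hab fun x _ => sq_nonneg _
  have h1 : ∫ x in a..b, ((b - a) * |f x| - I) ^ 2
      = (b - a) ^ 2 * J - 2 * (b - a) * I * I + (b - a) * I ^ 2 := by
    have he : ∀ x, ((b - a) * |f x| - I) ^ 2
        = (b - a) ^ 2 * f x ^ 2 - 2 * (b - a) * I * |f x| + I ^ 2 := fun x => by
      rw [← sq_abs (f x)]; ring
    simp_rw [he]
    rw [intervalIntegral.integral_add, intervalIntegral.integral_sub,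
      intervalIntegral.integral_const_mul, intervalIntegral.integral_const_mul,
      intervalIntegral.integral_const, smul_eq_mul] <;>
    exact Continuous.intervalIntegrable (by fun_prop) _ _
  have h2 : I ^ 2 ≤ (b - a) * J := by
    rw [h1] at h0
    by_contra! hlt
    nlinarith [mul_pos hL (sub_pos.2 hlt)]
  rw [← Real.sqrt_mul hL.le]
  exact Real.le_sqrt_of_sq_le h2

theorem LinfNorm_le {f : ℝ → ℝ} {B : ℝ} (h : ∀ x, |f x| ≤ B) : LinfNorm f ≤ B :=
  csSup_le ((Set.nonempty_Icc.2 zero_le_one).image _) (by rintro _ ⟨x, _, rfl⟩; exact h x)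

theorem LinfNorm_nonneg (f : ℝ → ℝ) : 0 ≤ LinfNorm f :=
  Real.sSup_nonneg (by rintro _ ⟨x, _, rfl⟩; exact abs_nonneg _)

/-- The effective viscous flux `Σ = μ ∂ₓu - P_γ(ρ)`. -/
noncomputable def viscousFlux (μ γ : ℝ) (P : ℝ → ℝ) (ρ u : ℝ → ℝ → ℝ) (t x : ℝ) : ℝ :=
  μ * deriv (u t) x - artificialPressure P γ (ρ t x)

section Pressure

variable {P : ℝ → ℝ} {γ β a : ℝ}

theorem IsAdmissiblePair.contDiffOn_Ioi (h : IsAdmissiblePair P γ β a) :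
    ContDiffOn ℝ 1 P (Set.Ioi 0) := h.smooth.mono Set.Ioi_subset_Ici_self

theorem IsAdmissiblePair.hasDerivAt_artificialPressure (h : IsAdmissiblePair P γ β a)
    {r : ℝ} (hr : 0 < r) :
    HasDerivAt (artificialPressure P γ) (deriv P r + γ * r) r := by
  have hP : HasDerivAt P (deriv P r) r :=
    ((h.contDiffOn_Ioi.differentiableOn (by simp)).differentiableAt (Ioi_mem_nhds hr)).hasDerivAt
  have h2 := hP.add (((hasDerivAt_id r).pow 2).const_mul (γ / 2))
  refine h2.congr_deriv ?_
  simp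
  ring

theorem IsAdmissiblePair.continuousOn_deriv (h : IsAdmissiblePair P γ β a) :
    ContinuousOn (deriv P) (Set.Ioi 0) :=
  h.contDiffOn_Ioi.continuousOn_deriv_of_isOpen isOpen_Ioi le_rfl

theorem IsAdmissiblePair.abs_le_sSup (h : IsAdmissiblePair P γ β a) {c d r : ℝ} (hc : 0 < c)
    (hr : r ∈ Set.Icc c d) :
    |artificialPressure P γ r|
      ≤ sSup ((fun l => |artificialPressure P γ l|) '' Set.Icc c d) := by
  have hcont : ContinuousOn (fun l => |artificialPressure P γ l|) (Set.Icc c d) := fun l hl =>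
    (h.hasDerivAt_artificialPressure (hc.trans_le hl.1)).continuousAt.abs.continuousWithinAt
  exact le_csSup (isCompact_Icc.image_of_continuousOn hcont).bddAbove ⟨r, hr, rfl⟩

end Pressure

namespace IsNSKSolution

variable {μ κ γ β a : ℝ} {P : ℝ → ℝ} {ρ u c : ℝ → ℝ → ℝ} {ρ₀ u₀ : ℝ → ℝ}

theorem hasDerivAt_viscousFlux (h : IsNSKSolution μ κ γ P (Set.Ici 0) ρ u c ρ₀ u₀)
    (hP : IsAdmissiblePair P γ β a) {t : ℝ} (ht : 0 ≤ t) (x : ℝ) :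
    HasDerivAt (viscousFlux μ γ P ρ u t) (μ * deriv (deriv (u t)) x
      - (deriv P (ρ t x) + γ * ρ t x) * deriv (ρ t) x) x := by
  have h1 := hasDerivAt_slice (f := fun t => deriv (u t)) (contDiffOn_deriv_slice h.smooth_u) ht x
  have h2 := hasDerivAt_slice h.smooth_rho ht x
  rw [h1.deriv, h2.deriv]
  exact (h1.const_mul μ).sub ((hP.hasDerivAt_artificialPressure (h.rho_pos t x)).comp x h2)

theorem continuous_deriv_viscousFlux (h : IsNSKSolution μ κ γ P (Set.Ici 0) ρ u c ρ₀ u₀)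
    (hP : IsAdmissiblePair P γ β a) :
    Continuous (fun p : ℝ × ℝ => deriv (viscousFlux μ γ P ρ u (max p.1 0)) p.2) := by
  have hmap : ∀ p : ℝ × ℝ, (max p.1 0, p.2) ∈ Set.Ici (0:ℝ) ×ˢ (Set.univ : Set ℝ) :=
    fun p => ⟨Set.mem_Ici.2 (le_max_right _ _), trivial⟩
  have hcm : Continuous (fun p : ℝ × ℝ => (max p.1 0, p.2)) := by fun_prop
  have hu := (contDiffOn_deriv_slice (f := fun t => deriv (u t))
    (contDiffOn_deriv_slice h.smooth_u)).continuousOn.comp_continuous hcm hmap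
  have hρ := h.smooth_rho.continuousOn.comp_continuous hcm hmap
  have hρx := (contDiffOn_deriv_slice h.smooth_rho).continuousOn.comp_continuous hcm hmap
  have hP' := hP.continuousOn_deriv.comp_continuous hρ fun p => h.rho_pos _ _
  have he : (fun p : ℝ × ℝ => deriv (viscousFlux μ γ P ρ u (max p.1 0)) p.2) = fun p =>
      μ * deriv (deriv (u (max p.1 0))) p.2
      - (deriv P (ρ (max p.1 0) p.2) + γ * ρ (max p.1 0) p.2) * deriv (ρ (max p.1 0)) p.2 :=
    funext fun p => (h.hasDerivAt_viscousFlux hP (le_max_right _ _) _).deriv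
  rw [he]
  exact (hu.const_mul μ).sub ((hP'.add (hρ.const_mul γ)).mul hρx)

theorem continuous_L2norm_deriv_viscousFlux
    (h : IsNSKSolution μ κ γ P (Set.Ici 0) ρ u c ρ₀ u₀) (hP : IsAdmissiblePair P γ β a) :
    Continuous (fun t => L2norm (deriv (viscousFlux μ γ P ρ u (max t 0)))) := by
  refine Real.continuous_sqrt.comp
    (intervalIntegral.continuous_parametric_intervalIntegral_of_continuous' ?_ 0 1)
  exact (h.continuous_deriv_viscousFlux hP).pow 2

theorem continuous_deriv_viscousFlux_slice
    (h : IsNSKSolution μ κ γ P (Set.Ici 0) ρ u c ρ₀ u₀) (hP : IsAdmissiblePair P γ β a)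
    {t : ℝ} (ht : 0 ≤ t) : Continuous (deriv (viscousFlux μ γ P ρ u t)) := by
  have := (h.continuous_deriv_viscousFlux hP).comp (Continuous.prodMk_right t)
  simpa [Function.comp_def, max_eq_left ht] using this

theorem abs_deriv_u_le (h : IsNSKSolution μ κ γ P (Set.Ici 0) ρ u c ρ₀ u₀)
    (hP : IsAdmissiblePair P γ β a) (hμ : 0 < μ) {t K : ℝ} (ht : 0 ≤ t)
    (hK : ∀ x, |artificialPressure P γ (ρ t x)| ≤ K) (x : ℝ) :
    |deriv (u t) x| ≤ (2 * K + L2norm (deriv (viscousFlux μ γ P ρ u t))) / μ := by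
  obtain ⟨z, hz, hxz⟩ :=
    (periodic_deriv (h.periodic_u t)).exists_mem_Ico₀ one_pos x
  rw [hxz]
  obtain ⟨y, hy, hy0⟩ := exists_deriv_eq_zero (f := u t) one_pos
    (continuous_slice h.smooth_u ht).continuousOn (by simpa using (h.periodic_u t 0).symm)
  have hc := h.continuous_deriv_viscousFlux_slice hP ht
  have hftc : ∫ s in y..z, deriv (viscousFlux μ γ P ρ u t) s
      = viscousFlux μ γ P ρ u t z - viscousFlux μ γ P ρ u t y :=
    intervalIntegral.integral_deriv_eq_sub
      (fun s _ => (h.hasDerivAt_viscousFlux hP ht s).differentiableAt) (hc.intervalIntegrable _ _)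
  have hle : |viscousFlux μ γ P ρ u t z - viscousFlux μ γ P ρ u t y|
      ≤ L2norm (deriv (viscousFlux μ γ P ρ u t)) := by
    rw [← hftc]
    calc |∫ s in y..z, deriv (viscousFlux μ γ P ρ u t) s|
        ≤ |∫ s in y..z, (|deriv (viscousFlux μ γ P ρ u t) s|)| :=
          intervalIntegral.norm_integral_le_abs_integral_norm (μ := volume)
            (f := deriv (viscousFlux μ γ P ρ u t))
      _ ≤ |∫ s in (0:ℝ)..1, (|deriv (viscousFlux μ γ P ρ u t) s|)| := by
          refine intervalIntegral.abs_integral_mono_interval ?_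
            (Eventually.of_forall fun _ => abs_nonneg _) (hc.abs.intervalIntegrable _ _)
          rw [Set.uIoc_of_le zero_le_one]
          exact Set.Ioc_subset_Ioc (le_min hy.1.le hz.1) (max_le hy.2.le hz.2.le)
      _ = ∫ s in (0:ℝ)..1, |deriv (viscousFlux μ γ P ρ u t) s| :=
          abs_of_nonneg (intervalIntegral.integral_nonneg zero_le_one fun _ _ => abs_nonneg _)
      _ ≤ _ := (integral_abs_le_sqrt_mul hc zero_le_one).trans (by simp [L2norm])
  rw [le_div_iff₀ hμ, ← abs_of_pos hμ, ← abs_mul, abs_of_pos hμ]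
  simp only [viscousFlux, hy0] at hle ⊢
  have hz' := abs_le.1 (hK z)
  have hy' := abs_le.1 (hK y)
  have hle' := abs_le.1 hle
  rw [abs_le]
  constructor <;> linarith [hle'.1, hle'.2, hz'.1, hz'.2, hy'.1, hy'.2]

theorem exists_characteristic (h : IsNSKSolution μ κ γ P (Set.Ici 0) ρ u c ρ₀ u₀)
    {t : ℝ} (ht : 0 ≤ t) (x : ℝ) :
    ∃ X : ℝ → ℝ, X t = x ∧
      ∀ s ∈ Set.Icc 0 t, HasDerivWithinAt X (u s (X s)) (Set.Icc 0 t) s := by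
  obtain ⟨L, hL⟩ := exists_abs_le_of_periodic h.smooth_u.continuousOn h.periodic_u t
  obtain ⟨K, hK⟩ := exists_abs_le_of_periodic (f := fun s => deriv (u s))
    (contDiffOn_deriv_slice h.smooth_u).continuousOn (fun s => periodic_deriv (h.periodic_u s)) t
  have hpl : IsPicardLindelof u (tmin := 0) (tmax := t) ⟨t, ht, le_rfl⟩ x
      (L * t.toNNReal) 0 L K :=
    { lipschitzOnWith := fun s hs => (lipschitzWith_of_nnnorm_deriv_le
        (fun y => (hasDerivAt_slice h.smooth_u hs.1 y).differentiableAt)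
        (fun y => hK s hs y)).lipschitzOnWith
      continuousOn := fun y _ => h.smooth_u.continuousOn.comp
        (Continuous.prodMk_left y).continuousOn fun s hs => ⟨hs.1, trivial⟩
      norm_le := fun s hs y _ => hL s hs y
      mul_max_le := by simp [ht] }
  obtain ⟨X, hX0, hX⟩ := hpl.exists_eq_forall_mem_Icc_hasDerivWithinAt₀
  exact ⟨X, hX0, hX⟩

theorem hasDerivAt_rho_characteristic (h : IsNSKSolution μ κ γ P (Set.Ici 0) ρ u c ρ₀ u₀)
    {X : ℝ → ℝ} {s : ℝ} (hs : 0 < s) (hX : HasDerivAt X (u s (X s)) s) :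
    HasDerivAt (fun r => ρ r (X r)) (-(ρ s (X s) * deriv (u s) (X s))) s := by
  have hd : HasFDerivAt (fun p : ℝ × ℝ => ρ p.1 p.2) _ (s, X s) :=
    ((h.smooth_rho.contDiffAt (prod_mem_nhds (Ici_mem_nhds hs)
      Filter.univ_mem)).differentiableAt (by simp)).hasFDerivAt
  have ht : HasDerivAt (fun r => ρ r (X s)) _ s :=
    hd.comp_hasDerivAt (f := fun r => (r, X s)) s
      ((hasDerivAt_id s).prodMk (hasDerivAt_const s (X s)))
  have hx : HasDerivAt (fun y => ρ s y) _ (X s) :=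
    hd.comp_hasDerivAt (f := fun y => (s, y)) (X s)
      ((hasDerivAt_const (X s) s).prodMk (hasDerivAt_id (X s)))
  have hu := (hasDerivAt_slice h.smooth_u hs.le (X s)).differentiableAt.hasDerivAt
  have hm := h.mass s hs.le (X s)
  rw [ht.deriv, (hx.fun_mul hu).deriv] at hm
  refine (hd.comp_hasDerivAt (f := fun r => (r, X r)) s
    ((hasDerivAt_id s).prodMk hX)).congr_deriv ?_
  have hsplit : ((1:ℝ), u s (X s)) = (1, 0) + u s (X s) • ((0:ℝ), (1:ℝ)) := by simp
  rw [hsplit, map_add, map_smul, smul_eq_mul]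
  linear_combination hm

theorem exists_abs_log_rho_sub_le (h : IsNSKSolution μ κ γ P (Set.Ici 0) ρ u c ρ₀ u₀)
    {B : ℝ → ℝ} (hB : Continuous B) {t : ℝ} (ht : 0 ≤ t)
    (hle : ∀ s ∈ Set.Icc 0 t, ∀ x, |deriv (u s) x| ≤ B s) (x : ℝ) :
    ∃ y, |Real.log (ρ t x) - Real.log (ρ 0 y)| ≤ ∫ s in (0:ℝ)..t, B s := by
  obtain ⟨X, hXt, hX⟩ := h.exists_characteristic ht x
  have hXc : ContinuousOn X (Set.Icc 0 t) := fun s hs => (hX s hs).continuousWithinAt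
  have hpc : ContinuousOn (fun s => (s, X s)) (Set.Icc 0 t) := continuousOn_id.prodMk hXc
  have hmaps : Set.MapsTo (fun s => (s, X s)) (Set.Icc 0 t)
      (Set.Ici (0:ℝ) ×ˢ (Set.univ : Set ℝ)) := fun s hs => ⟨hs.1, trivial⟩
  have hρ : ContinuousOn (fun s => Real.log (ρ s (X s))) (Set.Icc 0 t) :=
    (h.smooth_rho.continuousOn.comp hpc hmaps).log fun s _ => (h.rho_pos _ _).ne'
  have hux : ContinuousOn (fun s => -deriv (u s) (X s)) (Set.Icc 0 t) :=
    ((contDiffOn_deriv_slice h.smooth_u).continuousOn.comp hpc hmaps).neg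
  have hftc := intervalIntegral.integral_eq_sub_of_hasDerivAt_of_le ht hρ
    (f' := fun s => -deriv (u s) (X s)) (fun s hs => by
      have hXs := (hX s (Set.Ioo_subset_Icc_self hs)).hasDerivAt (Icc_mem_nhds hs.1 hs.2)
      refine ((h.hasDerivAt_rho_characteristic hs.1 hXs).log
        (h.rho_pos _ _).ne').congr_deriv ?_
      have := (h.rho_pos s (X s)).ne'
      field_simp)
    (hux.intervalIntegrable_of_Icc (μ := volume) ht)
  refine ⟨X 0, ?_⟩
  rw [hXt] at hftc
  rw [← hftc, ← Real.norm_eq_abs]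
  refine intervalIntegral.norm_integral_le_of_norm_le (μ := volume) ht
    (Eventually.of_forall fun s hs => ?_) (hB.intervalIntegrable _ _)
  rw [norm_neg]
  exact hle s (Set.Ioc_subset_Icc_self hs) _

end IsNSKSolution

theorem intervalIntegral_le_of_nonneg_of_le {f g : ℝ → ℝ} {a b : ℝ} (hab : a ≤ b)
    (hf : ∀ x, 0 ≤ f x) (hg : IntervalIntegrable g volume a b)
    (hfg : ∀ x ∈ Set.Icc a b, f x ≤ g x) :
    ∫ x in a..b, f x ≤ ∫ x in a..b, g x := by
  rw [intervalIntegral.integral_of_le hab, intervalIntegral.integral_of_le hab]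
  refine integral_mono_of_nonneg (Eventually.of_forall hf) hg.1 ?_
  filter_upwards [ae_restrict_mem measurableSet_Ioc] with x hx
  exact hfg x (Set.Ioc_subset_Icc_self hx)

theorem L2norm_mul_sub_sq_le {f g : ℝ → ℝ} (hf : Continuous f) (hg : Continuous g)
    {μ A K : ℝ} (hA : ∫ x in (0:ℝ)..1, f x ^ 2 ≤ A ^ 2) (hK : ∀ x, |g x| ≤ K) :
    L2norm (fun x => μ * f x - g x) ^ 2 ≤ 2 * μ ^ 2 * A ^ 2 + 2 * K ^ 2 := by
  rw [L2norm, Real.sq_sqrt (intervalIntegral.integral_nonneg zero_le_one fun _ _ => sq_nonneg _)]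
  calc ∫ x in (0:ℝ)..1, (μ * f x - g x) ^ 2
      ≤ ∫ x in (0:ℝ)..1, (2 * μ ^ 2 * f x ^ 2 + 2 * K ^ 2) := by
        refine intervalIntegral.integral_mono_on zero_le_one
          (Continuous.intervalIntegrable (by fun_prop) _ _)
          (Continuous.intervalIntegrable (by fun_prop) _ _) fun x _ => ?_
        have : g x ^ 2 ≤ K ^ 2 := by
          rw [← sq_abs]; exact pow_le_pow_left₀ (abs_nonneg _) (hK x) 2
        nlinarith [sq_nonneg (μ * f x + g x)]
    _ = 2 * μ ^ 2 * (∫ x in (0:ℝ)..1, f x ^ 2) + 2 * K ^ 2 := by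
        rw [intervalIntegral.integral_add (Continuous.intervalIntegrable (by fun_prop) _ _)
          (Continuous.intervalIntegrable (by fun_prop) _ _), intervalIntegral.integral_const_mul]
        simp
    _ ≤ _ := by gcongr

/-- The maximum of `|P_γ|` over `[(2M₀)⁻¹, 2M₀]`. -/
noncomputable def pressureBound (M₀ γ : ℝ) (P : ℝ → ℝ) : ℝ :=
  sSup ((fun l => |artificialPressure P γ l|) '' Set.Icc (2 * M₀)⁻¹ (2 * M₀))

/-- An upper bound for `K_u` in terms of `M₀`, `A = ‖u₀‖_{H¹}`, `μ`, `γ` and `P`. -/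
noncomputable def fluxBound (M₀ A μ γ : ℝ) (P : ℝ → ℝ) : ℝ :=
  8 / μ ^ 2 * (2 + 5 * M₀ * μ) *
    (2 * μ ^ 2 * A ^ 2 + 2 * pressureBound M₀ γ P ^ 2 + 1 + pressureBound M₀ γ P ^ 2)

/-- The constant `K_d` in the bound `∫ ‖∂ₓu‖_{L∞} ≤ √T · K_d`. -/
noncomputable def gradientBound (M₀ A μ γ : ℝ) (P : ℝ → ℝ) : ℝ :=
  (2 * pressureBound M₀ γ P + Real.sqrt (fluxBound M₀ A μ γ P)) / μ

theorem pressureBound_nonneg (M₀ γ : ℝ) (P : ℝ → ℝ) : 0 ≤ pressureBound M₀ γ P :=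
  Real.sSup_nonneg (by rintro _ ⟨x, _, rfl⟩; exact abs_nonneg _)

theorem fluxBound_pos {M₀ μ : ℝ} (hM : 0 < M₀) (hμ : 0 < μ) (A γ : ℝ) (P : ℝ → ℝ) :
    0 < fluxBound M₀ A μ γ P := by
  unfold fluxBound; positivity

theorem gradientBound_pos {M₀ μ : ℝ} (hM : 0 < M₀) (hμ : 0 < μ) (A γ : ℝ) (P : ℝ → ℝ) :
    0 < gradientBound M₀ A μ γ P := by
  have := Real.sqrt_pos.2 (fluxBound_pos hM hμ A γ P)
  have := pressureBound_nonneg M₀ γ P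
  unfold gradientBound; positivity

theorem integral_gradientBound_le {M₀ A μ γ T : ℝ} {P G : ℝ → ℝ} (hμ : 0 < μ)
    (hT : 0 ≤ T) (hT1 : T ≤ 1) (hG : Continuous G) (hG0 : ∀ t, 0 ≤ G t)
    (hint : ∫ t in (0:ℝ)..T, G t ^ 2 ≤ fluxBound M₀ A μ γ P) :
    ∫ t in (0:ℝ)..T, (2 * pressureBound M₀ γ P + G t) / μ
      ≤ Real.sqrt T * gradientBound M₀ A μ γ P := by
  have h1 : ∫ t in (0:ℝ)..T, G t ≤ Real.sqrt T * Real.sqrt (fluxBound M₀ A μ γ P) := by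
    have := integral_abs_le_sqrt_mul hG hT
    simp only [abs_of_nonneg (hG0 _), sub_zero] at this
    exact this.trans (by gcongr)
  have h2 : T ≤ Real.sqrt T := Real.le_sqrt_of_sq_le (by nlinarith)
  have h3 := pressureBound_nonneg M₀ γ P
  rw [intervalIntegral.integral_div, intervalIntegral.integral_add
    intervalIntegrable_const (hG.intervalIntegrable _ _), intervalIntegral.integral_const,
    gradientBound, ← mul_div_assoc, smul_eq_mul, sub_zero, mul_add]
  gcongr

theorem bounds_of_abs_log_sub_le {r r₀ M ε : ℝ} (hM : 0 < M) (hr : 0 < r) (h₁ : M⁻¹ ≤ r₀)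
    (h₂ : r₀ ≤ M) (hlog : |Real.log r - Real.log r₀| ≤ ε) (hε : ε ≤ Real.log (3 / 2)) :
    2 / (3 * M) ≤ r ∧ r ≤ 3 / 2 * M := by
  have hr₀ : 0 < r₀ := (inv_pos.2 hM).trans_le h₁
  have h := abs_le.1 (hlog.trans hε)
  constructor
  · have : r₀ ≤ 3 / 2 * r := by
      rw [← Real.log_le_log_iff hr₀ (by positivity), Real.log_mul (by norm_num) hr.ne']
      linarith [h.1]
    calc 2 / (3 * M) = 2 / 3 * M⁻¹ := by field_simp
      _ ≤ r := by linarith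
  · have : r ≤ 3 / 2 * r₀ := by
      rw [← Real.log_le_log_iff hr (by positivity), Real.log_mul (by norm_num) hr₀.ne']
      linarith [h.2]
    linarith

/-- First refinement lemma: under the a-priori bounds `(2M₀)⁻¹ ≤ ρ ≤ 2M₀` and the
`K_u`-bound for `∂ₓu` and `∂ₓΣ` on `[0, T̃₀]` with `T̃₀ ∈ (0,1)`, there are `T_ρ > 0`
and `K_d > 0`, depending only on `M₀`, `‖u₀‖_{H¹}`, `μ`, `γ`, `κ`, `P` and `W`, such
that if `T̃₀ < T_ρ` then `∫₀^{T̃₀} ‖∂ₓu‖_{L∞} ≤ √T̃₀ · K_d` and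
`2/(3M₀) ≤ ρ ≤ (3/2)M₀` on `[0,T̃₀] × ℝ`. -/
theorem refined_velocity_density_bound :
    ∃ Trho Kd : ℝ → ℝ → ℝ → ℝ → ℝ → (ℝ → ℝ) → (ℝ → ℝ) → ℝ,
      ∀ (μ κ γ M₀ β a : ℝ) (P W : ℝ → ℝ) (ρ u c : ℝ → ℝ → ℝ) (ρ₀ u₀ : ℝ → ℝ),
        0 < μ → 0 < κ → 0 < γ → 0 < M₀ →
        IsAdmissiblePair P γ β a → IsPressurePotential P W →
        IsNSKSolution μ κ γ P (Set.Ici 0) ρ u c ρ₀ u₀ →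
        (∀ x : ℝ, M₀⁻¹ ≤ ρ₀ x ∧ ρ₀ x ≤ M₀) →
        0 < Trho M₀ (H1norm u₀) μ γ κ P W ∧
        0 < Kd M₀ (H1norm u₀) μ γ κ P W ∧
        ∀ T₀' ∈ Set.Ioo (0:ℝ) 1,
          (∀ t ∈ Set.Icc 0 T₀', ∀ x : ℝ, (2 * M₀)⁻¹ ≤ ρ t x ∧ ρ t x ≤ 2 * M₀) →
          ((⨆ t ∈ Set.Icc 0 T₀', L2norm (fun x => deriv (u t) x) ^ 2)
              + (∫ t in (0:ℝ)..T₀',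
                  L2norm (fun x =>
                    deriv (fun y => μ * deriv (u t) y - artificialPressure P γ (ρ t y)) x) ^ 2)
            ≤ 8 / μ ^ 2 * (2 + 5 * M₀ * μ)
                * (L2norm (fun x => μ * deriv u₀ x - artificialPressure P γ (ρ₀ x)) ^ 2 + 1
                  + (sSup ((fun l => |artificialPressure P γ l|)
                      '' Set.Icc (2 * M₀)⁻¹ (2 * M₀))) ^ 2)) →
          T₀' < Trho M₀ (H1norm u₀) μ γ κ P W →
          (∫ t in (0:ℝ)..T₀', LinfNorm (fun x => deriv (u t) x))
              ≤ Real.sqrt T₀' * Kd M₀ (H1norm u₀) μ γ κ P W ∧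
            ∀ t ∈ Set.Icc 0 T₀', ∀ x : ℝ,
              2 / (3 * M₀) ≤ ρ t x ∧ ρ t x ≤ 3 / 2 * M₀ := by
  refine ⟨fun M₀ A μ γ _ P _ => (Real.log (3 / 2) / gradientBound M₀ A μ γ P) ^ 2,
    fun M₀ A μ γ _ P _ => gradientBound M₀ A μ γ P, ?_⟩
  intro μ κ γ M₀ β a P W ρ u c ρ₀ u₀ hμ _ _ hM hP _ h hρ₀
  have hKd := gradientBound_pos hM hμ (H1norm u₀) γ P
  have hlog : 0 < Real.log (3 / 2) := Real.log_pos (by norm_num)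
  refine ⟨by positivity, hKd, ?_⟩
  rintro T ⟨hT, hT1⟩ hρ hKu hTρ
  obtain rfl : ρ 0 = ρ₀ := funext h.init_rho
  obtain rfl : u 0 = u₀ := funext h.init_u
  set A := H1norm (u 0)
  have hK : ∀ t ∈ Set.Icc 0 T, ∀ x,
      |artificialPressure P γ (ρ t x)| ≤ pressureBound M₀ γ P := fun t ht x =>
    hP.abs_le_sSup (by positivity) (hρ t ht x)
  have hρc : Continuous (ρ 0) := continuous_slice h.smooth_rho le_rfl
  have huc : Continuous (u 0) := continuous_slice h.smooth_u le_rfl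
  have huxc : Continuous (deriv (u 0)) :=
    continuous_slice (f := fun t => deriv (u t)) (contDiffOn_deriv_slice h.smooth_u) le_rfl
  have hA : ∫ x in (0:ℝ)..1, deriv (u 0) x ^ 2 ≤ A ^ 2 := by
    rw [show A = Real.sqrt (∫ x in (0:ℝ)..1, u 0 x ^ 2 + deriv (u 0) x ^ 2) from rfl,
      Real.sq_sqrt (intervalIntegral.integral_nonneg zero_le_one fun _ _ => by positivity)]
    refine intervalIntegral.integral_mono_on zero_le_one
      (Continuous.intervalIntegrable (by fun_prop) _ _)
      (Continuous.intervalIntegrable (by fun_prop) _ _) fun x _ => ?_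
    linarith [sq_nonneg (u 0 x)]
  have hflux₀ := L2norm_mul_sub_sq_le huxc
    (continuous_iff_continuousAt.2 fun x =>
      (hP.hasDerivAt_artificialPressure (h.rho_pos 0 x)).continuousAt.comp hρc.continuousAt)
    (μ := μ) hA (hK 0 ⟨le_rfl, hT.le⟩)
  have hsup : 0 ≤ ⨆ t ∈ Set.Icc 0 T, L2norm (fun x => deriv (u t) x) ^ 2 :=
    Real.iSup_nonneg fun t => Real.iSup_nonneg fun _ => sq_nonneg _
  set G : ℝ → ℝ := fun t => L2norm (deriv (viscousFlux μ γ P ρ u (max t 0))) with hGdef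
  have hG : Continuous G := h.continuous_L2norm_deriv_viscousFlux hP
  have hG0 : ∀ t, 0 ≤ G t := fun t => Real.sqrt_nonneg _
  have hGint : ∫ t in (0:ℝ)..T, G t ^ 2 ≤ fluxBound M₀ A μ γ P := by
    have he : ∫ t in (0:ℝ)..T, G t ^ 2 = ∫ t in (0:ℝ)..T, L2norm (fun x =>
        deriv (fun y => μ * deriv (u t) y - artificialPressure P γ (ρ t y)) x) ^ 2 := by
      refine intervalIntegral.integral_congr fun t ht => ?_
      rw [Set.uIcc_of_le hT.le] at ht
      simp only [hGdef, max_eq_left ht.1]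
      rfl
    rw [he]
    refine (le_add_of_nonneg_left hsup).trans (hKu.trans ?_)
    exact mul_le_mul_of_nonneg_left
      (add_le_add_left (add_le_add_left hflux₀ 1) _) (by positivity)
  have hux : ∀ t ∈ Set.Icc 0 T, ∀ x,
      |deriv (u t) x| ≤ (2 * pressureBound M₀ γ P + G t) / μ := fun t ht x => by
    simpa only [hGdef, max_eq_left ht.1] using h.abs_deriv_u_le hP hμ ht.1 (hK t ht) x
  have hB : Continuous fun t => (2 * pressureBound M₀ γ P + G t) / μ := by fun_prop
  have hBint := integral_gradientBound_le hμ hT.le hT1.le hG hG0 hGint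
  refine ⟨(intervalIntegral_le_of_nonneg_of_le hT.le (fun t => LinfNorm_nonneg _)
    (hB.intervalIntegrable _ _) fun t ht => LinfNorm_le (hux t ht)).trans hBint, ?_⟩
  intro t ht x
  obtain ⟨y, hy⟩ := h.exists_abs_log_rho_sub_le hB ht.1
    (fun s hs => hux s ⟨hs.1, hs.2.trans ht.2⟩) x
  refine bounds_of_abs_log_sub_le hM (h.rho_pos t x) (hρ₀ y).1 (hρ₀ y).2 hy ?_
  calc ∫ s in (0:ℝ)..t, (2 * pressureBound M₀ γ P + G s) / μ
      ≤ ∫ s in (0:ℝ)..T, (2 * pressureBound M₀ γ P + G s) / μ :=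
        intervalIntegral.integral_mono_interval le_rfl ht.1 ht.2
          (Eventually.of_forall fun s => div_nonneg
            (add_nonneg (mul_nonneg zero_le_two (pressureBound_nonneg _ _ _)) (hG0 s)) hμ.le)
          (hB.intervalIntegrable _ _)
    _ ≤ Real.sqrt T * gradientBound M₀ A μ γ P := hBint
    _ ≤ Real.log (3 / 2) := by
        rw [← le_div_iff₀ hKd]
        exact Real.sqrt_le_iff.2 ⟨by positivity, hTρ.le⟩
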